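/- A face cannot be shared by more than two n-simplices with pairwise disjoint interiors: let q₀, …, q_{n−1} be affinely independent points of ℝⁿ and let w₁, w₂, w₃ be points such that for each a ∈ {1,2,3} the points q₀, …, q_{n−1}, w_a are affinely independent, with the three simplices Tᵃ = conv{q₀, …, q_{n−1}, w_a} having pairwise disjoint interiors. Then no three such simplices exist, i.e., the hypotheses are contradictory. -/

import Mathlib

open Set

open scoped Topology

namespace AffineBasis

/-- If two affine bases agree away from the index `i₀`, then their `i₀`-th barycentric
coordinates are proportional. -/
theorem coord_eq_mul_coord_of_eq_off {ι k V P : Type*} [CommRing k] [AddCommGroup V] [Module k V]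
    [AddTorsor V P] (B C : AffineBasis ι k P) {i₀ : ι} (h : ∀ i, i ≠ i₀ → B i = C i) (x : P) :
    C.coord i₀ x = C.coord i₀ (B i₀) * B.coord i₀ x := by
  have key : C.coord i₀ = C.coord i₀ (B i₀) • B.coord i₀ := by
    refine AffineMap.ext_on B.tot ?_
    rintro _ ⟨i, rfl⟩
    by_cases hi : i = i₀
    · subst hi
      simp
    · simp only [AffineMap.coe_smul, Pi.smul_apply, B.coord_apply_ne (Ne.symm hi), smul_zero]
      rw [h i hi, C.coord_apply_ne (Ne.symm hi)]
  simpa using DFunLike.congr_fun key x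

/-- If two affine bases agree away from `i₀` and their `i₀`-th points lie on the same side of the
common face, then the interiors of the two simplices intersect. -/
theorem interior_convexHull_inter_nonempty {ι E : Type*} [Fintype ι] [Nontrivial ι]
    [NormedAddCommGroup E] [NormedSpace ℝ E] (B C : AffineBasis ι ℝ E) {i₀ : ι}
    (h : ∀ i, i ≠ i₀ → B i = C i) (hpos : 0 < C.coord i₀ (B i₀)) :
    (interior (convexHull ℝ (range B)) ∩ interior (convexHull ℝ (range C))).Nonempty := by
  classical
  set s : Finset ι := Finset.univ.erase i₀
  obtain ⟨j, hj⟩ := exists_ne i₀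
  have hs : s.Nonempty := ⟨j, by simp [s, hj]⟩
  have hw : ∑ i ∈ s, s.centroidWeights ℝ i = 1 :=
    s.sum_centroidWeights_eq_one_of_nonempty ℝ hs
  set m : E := s.centroid ℝ B
  have hm : m = s.centroid ℝ C :=
    s.affineCombination_congr (fun _ _ ↦ rfl) fun i hi ↦ h i (Finset.ne_of_mem_erase hi)
  have hB₀ : B.coord i₀ m = 0 := B.coord_apply_combination_of_notMem (by simp [s]) hw
  have hC₀ : C.coord i₀ m = 0 := by
    rw [hm]
    exact C.coord_apply_combination_of_notMem (by simp [s]) hw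
  have hcard : (0 : ℝ) < (s.card : ℝ)⁻¹ := by
    have := hs.card_pos
    positivity
  have hBi : ∀ i, i ≠ i₀ → 0 < B.coord i m := fun i hi ↦ by
    rw [B.coord_apply_centroid (by simp [s, hi])]
    exact hcard
  have hCi : ∀ i, i ≠ i₀ → 0 < C.coord i m := fun i hi ↦ by
    rw [hm, C.coord_apply_centroid (by simp [s, hi])]
    exact hcard
  have near : ∀ D : AffineBasis ι ℝ E, D.coord i₀ m = 0 → 0 < D.coord i₀ (B i₀) →
      (∀ i, i ≠ i₀ → 0 < D.coord i m) →
      ∀ᶠ t in 𝓝[>] (0 : ℝ), AffineMap.lineMap m (B i₀) t ∈ interior (convexHull ℝ (range D)) := by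
    intro D h₀ h₁ hi
    simp only [D.interior_convexHull, mem_ofPred_eq, Filter.eventually_all]
    intro i
    simp only [AffineMap.apply_lineMap]
    by_cases hii : i = i₀
    · subst hii
      filter_upwards [self_mem_nhdsWithin] with t ht
      rw [h₀, AffineMap.lineMap_apply]
      simpa using mul_pos ht h₁
    · refine Filter.Eventually.filter_mono nhdsWithin_le_nhds ?_
      have hc : Continuous fun t : ℝ ↦
          AffineMap.lineMap (D.coord i m) (D.coord i (B i₀)) t :=
        AffineMap.lineMap_continuous
      exact hc.continuousAt.eventually (lt_mem_nhds (by simpa using hi i hii))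
  obtain ⟨t, h₁, h₂⟩ := ((near B hB₀ (by simp) hBi).and (near C hC₀ hpos hCi)).exists
  exact ⟨_, h₁, h₂⟩

end AffineBasis

/-- A face cannot be shared by more than two `n`-simplices with pairwise disjoint
interiors: if `q₀, …, q_{n−1}` are affinely independent and `w₁, w₂, w₃` are points
such that each family `q₀, …, q_{n−1}, wₐ` is affinely independent and the three
simplices `conv{q₀, …, q_{n−1}, wₐ}` have pairwise disjoint interiors, we get a
contradiction. -/
theorem no_three_simplices_share_a_face (n : ℕ) (hn : 1 ≤ n)
    (q : Fin n → EuclideanSpace ℝ (Fin n)) (hq : AffineIndependent ℝ q)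
    (w : Fin 3 → EuclideanSpace ℝ (Fin n))
    (hind : ∀ a, AffineIndependent ℝ (Fin.snoc q (w a)))
    (hdisj : ∀ a b, a ≠ b →
      interior (convexHull ℝ (Set.range (Fin.snoc q (w a)))) ∩
        interior (convexHull ℝ (Set.range (Fin.snoc q (w b)))) = ∅) :
    False := by
  have hspan : ∀ a, affineSpan ℝ (range (Fin.snoc q (w a) : Fin (n + 1) → _)) = ⊤ := fun a ↦
    (hind a).affineSpan_eq_top_iff_card_eq_finrank_add_one.mpr (by simp)
  let B (a : Fin 3) : AffineBasis (Fin (n + 1)) ℝ (EuclideanSpace ℝ (Fin n)) :=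
    ⟨Fin.snoc q (w a), hind a, hspan a⟩
  have : Nontrivial (Fin (n + 1)) := Fin.nontrivial_iff_two_le.mpr (by omega)
  have hB : ∀ a b i, i ≠ Fin.last n → B a i = B b i := by
    intro a b i hi
    obtain ⟨j, rfl⟩ := Fin.exists_castSucc_eq.mpr hi
    change (Fin.snoc q (w a) : Fin (n + 1) → _) j.castSucc =
      (Fin.snoc q (w b) : Fin (n + 1) → _) j.castSucc
    simp only [Fin.snoc_castSucc]
  have hside : ∀ a b, a ≠ b → (B b).coord (Fin.last n) (B a (Fin.last n)) ≤ 0 := by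
    intro a b hab
    by_contra! hlt
    have hne := (B a).interior_convexHull_inter_nonempty (B b) (hB a b) hlt
    exact hne.ne_empty (hdisj a b hab)
  have hmul := fun a b ↦ (B a).coord_eq_mul_coord_of_eq_off (B b) (hB a b)
  have h₂ := hmul 2 0 (B 0 (Fin.last n))
  have h₁₂ := hmul 1 0 (B 2 (Fin.last n))
  rw [AffineBasis.coord_apply_eq] at h₂
  have hnonneg := mul_nonneg_of_nonpos_of_nonpos (hside 1 0 (by decide)) (hside 2 1 (by decide))
  rw [← h₁₂] at hnonneg
  rw [le_antisymm (hside 2 0 (by decide)) hnonneg, zero_mul] at h₂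
  exact one_ne_zero h₂
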